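/- Let α̃ > 0, A a probability space of actions, and Q : Ω × A → ℝ jointly measurable, sub-Gaussian in ω for each a with mean μ(a) and uniformly bounded variance proxy σ²(a) ≤ M, with all required integrability. Then the overestimation error ε = E_ω[α̃ log ∫_A exp(Q(ω,a)/α̃) da] − α̃ log ∫_A exp(μ(a)/α̃) da satisfies 0 ≤ ε ≤ M/(2α̃); in particular ε → 0 as α̃ → ∞. -/

import Mathlib

open MeasureTheory Real Filter

/-- Jensen's inequality for the exponential on a probability space. -/
theorem exp_integral_le_integral_exp {Ω : Type*} [MeasurableSpace Ω] {P : Measure Ω}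
    [IsProbabilityMeasure P] {f : Ω → ℝ} (hf : Integrable f P)
    (hexp : Integrable (fun ω => Real.exp (f ω)) P) :
    Real.exp (∫ ω, f ω ∂P) ≤ ∫ ω, Real.exp (f ω) ∂P :=
  convexOn_exp.map_integral_le Real.continuous_exp.continuousOn isClosed_univ
    (by simp) hf hexp

/-- Almost every section of a function with integrable exponential has positive
exponential integral. -/
theorem ae_integral_exp_pos {Ω A : Type*} [MeasurableSpace Ω] [MeasurableSpace A]
    {P : Measure Ω} [IsProbabilityMeasure P] {ν : Measure A} [IsProbabilityMeasure ν]
    {f : Ω → A → ℝ}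
    (hexp : Integrable (Function.uncurry fun ω a => Real.exp (f ω a)) (P.prod ν)) :
    ∀ᵐ ω ∂P, 0 < ∫ a, Real.exp (f ω a) ∂ν := by
  filter_upwards [hexp.prod_right_ae] with ω hω
  exact integral_exp_pos hω

/-- The expected log-partition function is at most the logarithm of the expected
partition function. -/
theorem integral_log_integral_exp_le {Ω A : Type*} [MeasurableSpace Ω] [MeasurableSpace A]
    {P : Measure Ω} [IsProbabilityMeasure P] {ν : Measure A} [IsProbabilityMeasure ν]
    {f : Ω → A → ℝ}
    (hexp : Integrable (Function.uncurry fun ω a => Real.exp (f ω a)) (P.prod ν))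
    (hlog : Integrable (fun ω => Real.log (∫ a, Real.exp (f ω a) ∂ν)) P) :
    ∫ ω, Real.log (∫ a, Real.exp (f ω a) ∂ν) ∂P
      ≤ Real.log (∫ a, ∫ ω, Real.exp (f ω a) ∂P ∂ν) := by
  have hZ : (fun ω => Real.exp (Real.log (∫ a, Real.exp (f ω a) ∂ν)))
      =ᵐ[P] fun ω => ∫ a, Real.exp (f ω a) ∂ν := by
    filter_upwards [ae_integral_exp_pos hexp] with ω hω
    exact Real.exp_log hω
  have hjensen := exp_integral_le_integral_exp hlog
    ((integrable_congr hZ).2 hexp.integral_prod_left)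
  rw [integral_congr_ae hZ, integral_integral_swap hexp] at hjensen
  exact (Real.le_log_iff_exp_le ((Real.exp_pos _).trans_le hjensen)).2 hjensen

/-- The log-partition function of the mean is at most the expected log-partition function. -/
theorem log_integral_exp_integral_le {Ω A : Type*} [MeasurableSpace Ω] [MeasurableSpace A]
    {P : Measure Ω} [IsProbabilityMeasure P] {ν : Measure A} [IsProbabilityMeasure ν]
    {f : Ω → A → ℝ} (hf : Integrable (Function.uncurry f) (P.prod ν))
    (hexp : Integrable (Function.uncurry fun ω a => Real.exp (f ω a)) (P.prod ν))
    (hlog : Integrable (fun ω => Real.log (∫ a, Real.exp (f ω a) ∂ν)) P)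
    (hmean : Integrable (fun a => Real.exp (∫ ω, f ω a ∂P)) ν) :
    Real.log (∫ a, Real.exp (∫ ω, f ω a ∂P) ∂ν)
      ≤ ∫ ω, Real.log (∫ a, Real.exp (f ω a) ∂ν) ∂P := by
  set L : Ω → ℝ := fun ω => Real.log (∫ a, Real.exp (f ω a) ∂ν) with hL
  have hnorm : ∀ᵐ ω ∂P, ∫ a, Real.exp (f ω a - L ω) ∂ν = 1 := by
    filter_upwards [ae_integral_exp_pos hexp] with ω hω
    simp only [Real.exp_sub, integral_div, hL, Real.exp_log hω]
    exact div_self hω.ne'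
  have hdiff : Integrable (Function.uncurry fun ω a => f ω a - L ω) (P.prod ν) :=
    hf.sub (hlog.comp_fst ν)
  have hgibbs :
      Integrable (Function.uncurry fun ω a => Real.exp (f ω a - L ω)) (P.prod ν) := by
    refine (integrable_prod_iff
      (Real.continuous_exp.comp_aestronglyMeasurable hdiff.aestronglyMeasurable)).2 ⟨?_, ?_⟩
    · filter_upwards [hexp.prod_right_ae] with ω hω
      simpa only [Function.uncurry, Function.comp, Real.exp_sub] using
        hω.div_const (Real.exp (L ω))
    · refine (integrable_congr ?_).2 (integrable_const (1 : ℝ))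
      filter_upwards [hnorm] with ω hω
      simpa [Function.uncurry] using hω
  have hpoint : ∀ᵐ a ∂ν, Real.exp (∫ ω, f ω a ∂P) / Real.exp (∫ ω, L ω ∂P)
      ≤ ∫ ω, Real.exp (f ω a - L ω) ∂P := by
    filter_upwards [hf.prod_left_ae, hgibbs.prod_left_ae] with a ha hga
    simp only [Function.uncurry] at ha hga
    rw [← Real.exp_sub, ← integral_sub ha hlog]
    exact exp_integral_le_integral_exp (ha.sub hlog) hga
  have hle := integral_mono_ae (hmean.div_const _) hgibbs.integral_prod_right hpoint
  simp only [Function.uncurry] at hle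
  rw [integral_div, ← integral_integral_swap hgibbs, integral_congr_ae hnorm] at hle
  simp only [integral_const, probReal_univ, one_smul] at hle
  rw [div_le_one (Real.exp_pos _)] at hle
  exact (Real.log_le_iff_le_exp (integral_exp_pos hmean)).2 hle

open MeasureTheory Real Filter

/-- The overestimation error
`ε(α̃) = E_ω[α̃ log ∫ exp(Q(ω,a)/α̃) da] − α̃ log ∫ exp(μ(a)/α̃) da` of a sub-Gaussian
critic with variance proxies uniformly bounded by `M` satisfies `0 ≤ ε ≤ M/(2α̃)`
for every temperature `α̃ > 0`; in particular `ε → 0` as `α̃ → ∞`. -/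
theorem overestimation_sandwich {Ω A : Type*} [MeasurableSpace Ω] [MeasurableSpace A]
    (P : Measure Ω) [IsProbabilityMeasure P] (ν : Measure A) [IsProbabilityMeasure ν]
    (Q : Ω → A → ℝ) (μ σ2 : A → ℝ) (M : ℝ)
    (hmeas : Measurable (Function.uncurry Q)) (hμ : Measurable μ) (hσ2 : Measurable σ2)
    (hmean : ∀ a, ∫ ω, Q ω a ∂P = μ a)
    (hsub : ∀ a, ∀ l : ℝ,
      ∫ ω, Real.exp (l * Q ω a) ∂P ≤ Real.exp (l * μ a + l ^ 2 * σ2 a / 2))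
    (hσ2nonneg : ∀ a, 0 ≤ σ2 a) (hσ2M : ∀ a, σ2 a ≤ M)
    (hQint : Integrable (Function.uncurry Q) (P.prod ν))
    (hint : ∀ t : ℝ, 0 < t →
      Integrable (Function.uncurry fun ω a => Real.exp (Q ω a / t)) (P.prod ν))
    (hlogint : ∀ t : ℝ, 0 < t →
      Integrable (fun ω => Real.log (∫ a, Real.exp (Q ω a / t) ∂ν)) P)
    (hμint : ∀ t : ℝ, 0 < t → Integrable (fun a => Real.exp (μ a / t)) ν) :
    (∀ t : ℝ, 0 < t →
      0 ≤ (∫ ω, t * Real.log (∫ a, Real.exp (Q ω a / t) ∂ν) ∂P)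
            - t * Real.log (∫ a, Real.exp (μ a / t) ∂ν) ∧
      (∫ ω, t * Real.log (∫ a, Real.exp (Q ω a / t) ∂ν) ∂P)
            - t * Real.log (∫ a, Real.exp (μ a / t) ∂ν) ≤ M / (2 * t)) ∧
    Tendsto (fun t : ℝ => (∫ ω, t * Real.log (∫ a, Real.exp (Q ω a / t) ∂ν) ∂P)
            - t * Real.log (∫ a, Real.exp (μ a / t) ∂ν)) atTop (nhds 0) := by
  have hbound : ∀ t : ℝ, 0 < t →
      0 ≤ (∫ ω, t * Real.log (∫ a, Real.exp (Q ω a / t) ∂ν) ∂P)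
            - t * Real.log (∫ a, Real.exp (μ a / t) ∂ν) ∧
      (∫ ω, t * Real.log (∫ a, Real.exp (Q ω a / t) ∂ν) ∂P)
            - t * Real.log (∫ a, Real.exp (μ a / t) ∂ν) ≤ M / (2 * t) := by
    intro t ht
    have hmean' : ∀ a, ∫ ω, Q ω a / t ∂P = μ a / t := fun a => by
      rw [integral_div, hmean]
    have hμpos : 0 < ∫ a, Real.exp (μ a / t) ∂ν := integral_exp_pos (hμint t ht)
    have hlower := log_integral_exp_integral_le (f := fun ω a => Q ω a / t)
      (hQint.div_const t) (hint t ht) (hlogint t ht)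
      (by simpa only [hmean'] using hμint t ht)
    simp only [hmean'] at hlower
    have hupper := integral_log_integral_exp_le (f := fun ω a => Q ω a / t)
      (hint t ht) (hlogint t ht)
    have hpoint : ∀ a, ∫ ω, Real.exp (Q ω a / t) ∂P
        ≤ Real.exp (μ a / t) * Real.exp (M / (2 * t ^ 2)) := by
      intro a
      have h := hsub a t⁻¹
      simp only [inv_mul_eq_div] at h
      refine h.trans ?_
      rw [← Real.exp_add]
      have hM : t⁻¹ ^ 2 * σ2 a / 2 ≤ t⁻¹ ^ 2 * M / 2 := by
        gcongr
        exact hσ2M a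
      have heq : t⁻¹ ^ 2 * M / 2 = M / (2 * t ^ 2) := by
        field_simp
      exact Real.exp_le_exp.2 (by linarith)
    have hmgf : ∫ a, ∫ ω, Real.exp (Q ω a / t) ∂P ∂ν
        ≤ (∫ a, Real.exp (μ a / t) ∂ν) * Real.exp (M / (2 * t ^ 2)) := by
      rw [← integral_mul_const]
      exact integral_mono (hint t ht).integral_prod_right ((hμint t ht).mul_const _) hpoint
    have hpos : 0 < ∫ a, ∫ ω, Real.exp (Q ω a / t) ∂P ∂ν := by
      rw [← integral_integral_swap (hint t ht)]
      exact (integral_exp_pos (hint t ht)).trans_eq (integral_prod _ (hint t ht))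
    have hlogle := Real.log_le_log hpos hmgf
    rw [Real.log_mul hμpos.ne' (Real.exp_pos _).ne', Real.log_exp] at hlogle
    rw [integral_const_mul, ← mul_sub]
    refine ⟨mul_nonneg ht.le (sub_nonneg.2 hlower), ?_⟩
    calc _ ≤ t * (M / (2 * t ^ 2)) := by gcongr; linarith
      _ = M / (2 * t) := by field_simp
  refine ⟨hbound, ?_⟩
  have hlim : Tendsto (fun t : ℝ => M / (2 * t)) atTop (nhds 0) :=
    (tendsto_id.const_mul_atTop two_pos).const_div_atTop M
  refine tendsto_of_tendsto_of_tendsto_of_le_of_le' tendsto_const_nhds hlim ?_ ?_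
  · filter_upwards [eventually_gt_atTop 0] with t ht using (hbound t ht).1
  · filter_upwards [eventually_gt_atTop 0] with t ht using (hbound t ht).2
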